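/- Under hypotheses (H0)-(H4), the quantity I_min := inf over γ ∈ ℝ^{d−1}×{0} with |γ| = 1 of [ sup_{a∈D̂} a·γ + sup_{a∈D} a·(−γ) ] is strictly positive; i.e. inf_{γ∈ℝ^{d−1}×{0}, |γ|=1} (I(0,γ) + I⁺(γ,0)) > 0. -/

import Mathlib

open scoped ENNReal
open Filter MeasureTheory

namespace ReflectedRW

/-- `ℤ^d` realized as `ℤ^{d-1} × ℤ`. -/
abbrev Zd (d : ℕ) := (Fin (d-1) → ℤ) × ℤ
/-- `ℝ^d` realized as `ℝ^{d-1} × ℝ`. -/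
abbrev Rd (d : ℕ) := (Fin (d-1) → ℝ) × ℝ
/-- The state space `ℤ^{d-1} × ℕ` of the reflected walk. -/
abbrev St (d : ℕ) := (Fin (d-1) → ℤ) × ℕ

/-- Embedding of the state space into `ℤ^d`. -/
def toZ (d : ℕ) (z : St d) : Zd d := (z.1, (z.2 : ℤ))

/-- Embedding of `ℤ^d` into `ℝ^d`. -/
def toR (d : ℕ) (z : Zd d) : Rd d := (fun i => (z.1 i : ℝ), (z.2 : ℝ))

/-- Scalar product `a · z` of `a ∈ ℝ^d` and `z ∈ ℤ^d`. -/
noncomputable def dotZ (d : ℕ) (a : Rd d) (z : Zd d) : ℝ :=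
  (∑ i, a.1 i * (z.1 i : ℝ)) + a.2 * (z.2 : ℝ)

/-- Scalar product on `ℝ^d`. -/
noncomputable def dotR (d : ℕ) (a q : Rd d) : ℝ :=
  (∑ i, a.1 i * q.1 i) + a.2 * q.2

/-- One-step transition probabilities of the reflected random walk `Z(t)`:
jumps with law `μ` in the interior and with law `μ0` on the boundary `y = 0`. -/
noncomputable def step (d : ℕ) (μ μ0 : Zd d → ℝ) (z z' : St d) : ℝ≥0∞ :=
  if z.2 = 0 then ENNReal.ofReal (μ0 (toZ d z' - toZ d z))
  else ENNReal.ofReal (μ (toZ d z' - toZ d z))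

/-- Real-valued version of the transition kernel of `Z(t)`. -/
noncomputable def stepR (d : ℕ) (μ μ0 : Zd d → ℝ) (z z' : St d) : ℝ :=
  if z.2 = 0 then μ0 (toZ d z' - toZ d z) else μ (toZ d z' - toZ d z)

/-- `n`-step kernel obtained by iterating a sub-Markov kernel `p`. -/
noncomputable def kerIter {S : Type*} [DecidableEq S] (p : S → S → ℝ≥0∞) :
    ℕ → S → S → ℝ≥0∞
  | 0, z, z' => if z = z' then 1 else 0
  | n+1, z, z' => ∑' w : S, kerIter p n z w * p w z'

/-- `n`-step transition probabilities of `Z(t)`: `P_z(Z(n) = z')`. -/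
noncomputable def stepn (d : ℕ) (μ μ0 : Zd d → ℝ) : ℕ → St d → St d → ℝ≥0∞ :=
  kerIter (step d μ μ0)

/-- Green's function `G(z,z') = ∑_{t ≥ 0} P_z(Z(t) = z')` of the reflected walk. -/
noncomputable def green (d : ℕ) (μ μ0 : Zd d → ℝ) (z z' : St d) : ℝ≥0∞ :=
  ∑' n : ℕ, stepn d μ μ0 n z z'

/-- Kernel of the walk killed upon hitting the boundary hyperplane `y = 0`. -/
noncomputable def stepKilled (d : ℕ) (μ μ0 : Zd d → ℝ) (z z' : St d) : ℝ≥0∞ :=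
  if z'.2 = 0 then 0 else step d μ μ0 z z'

/-- `n`-step kernel of the killed walk: `P_z(Z(n) = z', τ > n)` where
`τ` is the first return time to the boundary hyperplane. -/
noncomputable def stepKilledn (d : ℕ) (μ μ0 : Zd d → ℝ) : ℕ → St d → St d → ℝ≥0∞ :=
  kerIter (stepKilled d μ μ0)

/-- Green's function `G₊(z,z')` of the killed walk. -/
noncomputable def greenPlus (d : ℕ) (μ μ0 : Zd d → ℝ) (z z' : St d) : ℝ≥0∞ :=
  ∑' n : ℕ, stepKilledn d μ μ0 n z z'

/-- One-step kernel of the homogeneous random walk `S(t)` on `ℤ^d`. -/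
noncomputable def stepS (d : ℕ) (μ : Zd d → ℝ) (z z' : Zd d) : ℝ≥0∞ :=
  ENNReal.ofReal (μ (z' - z))

/-- `n`-step kernel of the homogeneous random walk on `ℤ^d`. -/
noncomputable def stepSn (d : ℕ) (μ : Zd d → ℝ) : ℕ → Zd d → Zd d → ℝ≥0∞ :=
  kerIter (stepS d μ)

/-- Green's function `G_S` of the homogeneous random walk on `ℤ^d`. -/
noncomputable def greenS (d : ℕ) (μ : Zd d → ℝ) (z z' : Zd d) : ℝ≥0∞ :=
  ∑' n : ℕ, stepSn d μ n z z'

/-- `hitProb z w = P_z(τ < ∞, Z(τ) = w)`, the hitting distribution on the boundary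
hyperplane, `τ = inf{t ≥ 1 : Z(t) ∈ ℤ^{d-1}×{0}}`. -/
noncomputable def hitProb (d : ℕ) (μ μ0 : Zd d → ℝ) (z w : St d) : ℝ≥0∞ :=
  if w.2 = 0 then
    ∑' n : ℕ, ∑' v : St d, stepKilledn d μ μ0 n z v * step d μ μ0 v w
  else 0

/-- The jump generating function `φ(a) = ∑_z μ(z) e^{a·z}`. -/
noncomputable def jgf (d : ℕ) (μ : Zd d → ℝ) (a : Rd d) : ℝ :=
  ∑' z : Zd d, μ z * Real.exp (dotZ d a z)

/-- Partial derivative `∂φ/∂β` of the jump generating function in the last coordinate. -/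
noncomputable def jgfDβ (d : ℕ) (μ : Zd d → ℝ) (a : Rd d) : ℝ :=
  ∑' z : Zd d, μ z * (z.2 : ℝ) * Real.exp (dotZ d a z)

/-- Gradient `∇φ(a)` of the jump generating function. -/
noncomputable def jgfGrad (d : ℕ) (μ : Zd d → ℝ) (a : Rd d) : Rd d :=
  (fun i => ∑' z : Zd d, μ z * (z.1 i : ℝ) * Real.exp (dotZ d a z), jgfDβ d μ a)

/-- The set `D = {a : φ(a) ≤ 1}`. -/
def Dset (d : ℕ) (μ : Zd d → ℝ) : Set (Rd d) := {a | jgf d μ a ≤ 1}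

/-- `∂₊D`: points of the boundary of `D` where the last coordinate of `∇φ` is `≥ 0`. -/
def bdPlus (d : ℕ) (μ : Zd d → ℝ) : Set (Rd d) :=
  {a | jgf d μ a = 1 ∧ 0 ≤ jgfDβ d μ a}

/-- `∂₋D`: points of the boundary of `D` where the last coordinate of `∇φ` is `≤ 0`. -/
def bdMinus (d : ℕ) (μ : Zd d → ℝ) : Set (Rd d) :=
  {a | jgf d μ a = 1 ∧ jgfDβ d μ a ≤ 0}

/-- `∂₀D`: points of the boundary of `D` where the last coordinate of `∇φ` is `0`. -/
def bdZero (d : ℕ) (μ : Zd d → ℝ) : Set (Rd d) :=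
  {a | jgf d μ a = 1 ∧ jgfDβ d μ a = 0}

/-- `Θ = {α ∈ ℝ^{d-1} : inf_β max(φ(α,β), φ₀(α,β)) ≤ 1}`. -/
noncomputable def Theta (d : ℕ) (μ μ0 : Zd d → ℝ) : Set (Fin (d-1) → ℝ) :=
  {α | (⨅ β : ℝ, max (jgf d μ (α, β)) (jgf d μ0 (α, β))) ≤ 1}

/-- `D̂ = (Θ×ℝ) ∩ D`. -/
noncomputable def Dhat (d : ℕ) (μ μ0 : Zd d → ℝ) : Set (Rd d) :=
  {a | a.1 ∈ Theta d μ μ0 ∧ jgf d μ a ≤ 1}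

/-- Normal cone to a convex set `s ⊆ ℝ^d` at the point `a`. -/
noncomputable def normalCone (d : ℕ) (s : Set (Rd d)) (a : Rd d) : Set (Rd d) :=
  {q | ∀ b ∈ s, dotR d q (b - a) ≤ 0}

/-- The mean vector `m = ∑_z z μ(z)`. -/
noncomputable def meanVec (d : ℕ) (μ : Zd d → ℝ) : Rd d :=
  (fun i => ∑' z : Zd d, μ z * (z.1 i : ℝ), ∑' z : Zd d, μ z * (z.2 : ℝ))

/-- The harmonic functions `h_a` of (1-8), for `a ∈ D̂ ∩ ∂₊D` with associated
point `abar = ā ∈ ∂₋D` (same first `d-1` coordinates as `a`). -/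
noncomputable def hfun (d : ℕ) (μ μ0 : Zd d → ℝ) (a abar : Rd d) (z : St d) : ℝ :=
  if jgf d μ0 abar = 1 then Real.exp (dotZ d abar (toZ d z))
  else if a = abar then
    (z.2 : ℝ) * Real.exp (dotZ d a (toZ d z))
      + (jgfDβ d μ0 a / (1 - jgf d μ0 a)) * Real.exp (dotZ d a (toZ d z))
  else
    Real.exp (dotZ d a (toZ d z))
      - ((1 - jgf d μ0 a) / (1 - jgf d μ0 abar)) * Real.exp (dotZ d abar (toZ d z))

/-- `h : ℤ^{d-1}×ℕ → ℝ` is harmonic for the reflected walk. -/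
def IsHarmonic (d : ℕ) (μ μ0 : Zd d → ℝ) (h : St d → ℝ) : Prop :=
  ∀ z : St d, HasSum (fun z' => stepR d μ μ0 z z' * h z') (h z)

/-- Minimal nonnegative harmonic function. -/
def IsMinimalHarmonic (d : ℕ) (μ μ0 : Zd d → ℝ) (h : St d → ℝ) : Prop :=
  IsHarmonic d μ μ0 h ∧ (∀ z, 0 ≤ h z) ∧ h ≠ 0 ∧
    ∀ h' : St d → ℝ, IsHarmonic d μ μ0 h' → (∀ z, 0 ≤ h' z) → h' ≠ 0 →
      (∀ z, h' z ≤ h z) → ∃ c : ℝ, 0 < c ∧ h' = fun z => c * h z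

/- Hypotheses (H0)–(H4). -/

/-- `(H0)`: `μ(x,y) = 0` for `y < -1` and `μ₀(x,y) = 0` for `y < 0`. -/
def H0 (d : ℕ) (μ μ0 : Zd d → ℝ) : Prop :=
  (∀ z : Zd d, z.2 < -1 → μ z = 0) ∧ (∀ z : Zd d, z.2 < 0 → μ0 z = 0)

/-- `(H1)`: the reflected walk is irreducible on `ℤ^{d-1}×ℕ`. -/
def H1 (d : ℕ) (μ μ0 : Zd d → ℝ) : Prop :=
  ∀ z z' : St d, ∃ n : ℕ, 0 < stepn d μ μ0 n z z'

/-- `(H2)`: the homogeneous walk with step law `μ` is irreducible on `ℤ^d` and its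
last coordinate is an aperiodic random walk on `ℤ`. -/
def H2 (d : ℕ) (μ : Zd d → ℝ) : Prop :=
  (∀ z z' : Zd d, ∃ n : ℕ, 0 < stepSn d μ n z z') ∧
    AddSubgroup.closure {y : ℤ | ∃ x : Fin (d-1) → ℤ, μ (x, y) ≠ 0} = ⊤

/-- `(H3)`: `m ≠ 0` and `m/|m| + m₀/|m₀| ≠ 0`. -/
noncomputable def H3 (d : ℕ) (μ μ0 : Zd d → ℝ) : Prop :=
  meanVec d μ ≠ 0 ∧ meanVec d μ0 ≠ 0 ∧
    ‖meanVec d μ‖⁻¹ • meanVec d μ + ‖meanVec d μ0‖⁻¹ • meanVec d μ0 ≠ 0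

/-- `(H4)`: the jump generating functions are finite everywhere on `ℝ^d`. -/
def H4 (d : ℕ) (μ μ0 : Zd d → ℝ) : Prop :=
  ∀ a : Rd d, Summable (fun z : Zd d => μ z * Real.exp (dotZ d a z)) ∧
    Summable (fun z : Zd d => μ0 z * Real.exp (dotZ d a z))

/-- `μ` is a probability distribution on `ℤ^d`. -/
def IsProb (d : ℕ) (μ : Zd d → ℝ) : Prop :=
  (∀ z : Zd d, 0 ≤ μ z) ∧ HasSum μ 1


/-! ### Scalar products -/

theorem dotZ_eq_dotR (d : ℕ) (a : Rd d) (z : Zd d) : dotZ d a z = dotR d a (toR d z) := rfl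

theorem dotR_add_left (d : ℕ) (a b q : Rd d) : dotR d (a + b) q = dotR d a q + dotR d b q := by
  simp only [dotR, Prod.fst_add, Prod.snd_add, Pi.add_apply, add_mul, Finset.sum_add_distrib]
  ring

theorem dotR_smul_left (d : ℕ) (c : ℝ) (a q : Rd d) : dotR d (c • a) q = c * dotR d a q := by
  simp only [dotR, Prod.smul_fst, Prod.smul_snd, Pi.smul_apply, smul_eq_mul, mul_add,
    Finset.mul_sum, mul_assoc]

theorem dotR_comm (d : ℕ) (a q : Rd d) : dotR d a q = dotR d q a := by
  simp only [dotR, mul_comm]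

theorem dotR_neg_right (d : ℕ) (a q : Rd d) : dotR d a (-q) = -dotR d a q := by
  rw [dotR_comm, dotR_comm d a q, ← neg_one_smul ℝ q, dotR_smul_left]
  ring

theorem dotR_self_nonneg (d : ℕ) (a : Rd d) : 0 ≤ dotR d a a :=
  add_nonneg (Finset.sum_nonneg fun _ _ => mul_self_nonneg _) (mul_self_nonneg _)

theorem dotR_self_pos (d : ℕ) {a : Rd d} (ha : a ≠ 0) : 0 < dotR d a a := by
  refine lt_of_le_of_ne (dotR_self_nonneg d a) fun h => ha ?_
  have hs : (0 : ℝ) ≤ ∑ i, a.1 i * a.1 i := Finset.sum_nonneg fun _ _ => mul_self_nonneg _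
  have h2 : a.2 * a.2 = 0 := by
    have := mul_self_nonneg a.2
    unfold dotR at h
    linarith
  have h1 : ∑ i, a.1 i * a.1 i = 0 := by
    unfold dotR at h
    linarith
  rw [Finset.sum_eq_zero_iff_of_nonneg fun _ _ => mul_self_nonneg _] at h1
  ext i
  · simpa using h1 i (Finset.mem_univ i)
  · simpa using h2

/-- The Euclidean square norm dominates the square of the sup norm. -/
theorem norm_sq_le_dotR_self (d : ℕ) (a : Rd d) : ‖a‖ ^ 2 ≤ dotR d a a := by
  suffices h : ‖a‖ ≤ √(dotR d a a) by
    calc ‖a‖ ^ 2 ≤ √(dotR d a a) ^ 2 := by gcongr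
      _ = dotR d a a := Real.sq_sqrt (dotR_self_nonneg d a)
  have hs : (0 : ℝ) ≤ ∑ i, a.1 i * a.1 i := Finset.sum_nonneg fun _ _ => mul_self_nonneg _
  rw [Prod.norm_def, max_le_iff, pi_norm_le_iff_of_nonneg (Real.sqrt_nonneg _)]
  refine ⟨fun i => ?_, ?_⟩
  · refine Real.abs_le_sqrt ?_
    have := Finset.single_le_sum (f := fun i => a.1 i * a.1 i)
      (fun _ _ => mul_self_nonneg _) (Finset.mem_univ i)
    have h2 := mul_self_nonneg a.2
    simp only [dotR, sq]
    linarith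
  · refine Real.abs_le_sqrt ?_
    simp only [dotR, sq]
    linarith

/-- Two nonzero vectors that do not point in opposite directions lie in a common open
half-space. -/
theorem exists_dotR_neg_of_not_opposite (d : ℕ) {m m0 : Rd d} (hm : m ≠ 0) (hm0 : m0 ≠ 0)
    (h : ‖m‖⁻¹ • m + ‖m0‖⁻¹ • m0 ≠ 0) : ∃ v : Rd d, dotR d v m < 0 ∧ dotR d v m0 < 0 := by
  have hM := dotR_self_pos d hm
  have hM0 := dotR_self_pos d hm0
  obtain ⟨r, hr, hrM⟩ : ∃ r : ℝ, 0 < r ∧ dotR d m m = r ^ 2 :=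
    ⟨√(dotR d m m), Real.sqrt_pos.2 hM, (Real.sq_sqrt hM.le).symm⟩
  obtain ⟨s, hs, hsM⟩ : ∃ s : ℝ, 0 < s ∧ dotR d m0 m0 = s ^ 2 :=
    ⟨√(dotR d m0 m0), Real.sqrt_pos.2 hM0, (Real.sq_sqrt hM0.le).symm⟩
  have hc := dotR_comm d m0 m
  have hpos : 0 < r * s + dotR d m m0 := by
    have hw : s • m + r • m0 ≠ 0 := by
      intro hw
      have hm0' : m0 = (-(s / r)) • m := by
        have : r • m0 = (-s) • m := by
          rw [neg_smul]; exact eq_neg_of_add_eq_zero_right hw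
        rw [← inv_smul_smul₀ hr.ne' m0, this, smul_smul]
        congr 1
        field_simp
      apply h
      have hn : ‖m‖ ≠ 0 := norm_ne_zero_iff.2 hm
      have hn0 : ‖m0‖ = s / r * ‖m‖ := by
        rw [hm0', norm_smul, norm_neg, Real.norm_of_nonneg (by positivity)]
      rw [hn0, hm0', smul_smul, ← add_smul]
      have : ‖m‖⁻¹ + (s / r * ‖m‖)⁻¹ * -(s / r) = 0 := by
        field_simp
        ring
      rw [this, zero_smul]
    have h1 := dotR_self_pos d hw
    have h2 : dotR d (s • m + r • m0) (s • m + r • m0)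
        = 2 * (r * s) * (r * s + dotR d m m0) := by
      rw [dotR_add_left, dotR_smul_left, dotR_smul_left, dotR_comm d m, dotR_comm d m0,
        dotR_add_left, dotR_add_left, dotR_smul_left, dotR_smul_left, dotR_smul_left,
        dotR_smul_left, hrM, hsM, hc]
      ring
    rw [h2] at h1
    exact pos_of_mul_pos_right h1 (by positivity)
  refine ⟨(-1 : ℝ) • (s • m + r • m0), ?_, ?_⟩
  · rw [dotR_smul_left, dotR_add_left, dotR_smul_left, dotR_smul_left, hrM, hc]
    nlinarith [mul_pos hr hpos]
  · rw [dotR_smul_left, dotR_add_left, dotR_smul_left, dotR_smul_left, hsM]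
    nlinarith [mul_pos hs hpos]

/-! ### The jump generating function -/

theorem exp_mul_le_quadratic {t : ℝ} (ht0 : 0 ≤ t) (ht1 : t ≤ 1) (x : ℝ) :
    Real.exp (t * x) ≤ 1 + t * x + t ^ 2 *
      (2 * Real.exp (2 * x) + 2 + 4 * Real.exp x + 4 * Real.exp (-x)) := by
  have key : ∀ y : ℝ, Real.exp y ≤ 1 + y + y ^ 2 * (Real.exp y + 1) := by
    intro y
    have h1 := Real.add_one_le_exp y
    have h2 : Real.exp y - 1 ≤ y * Real.exp y := by
      have h := mul_le_mul_of_nonneg_left (Real.add_one_le_exp (-y)) (Real.exp_pos y).le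
      rw [← Real.exp_add, add_neg_cancel, Real.exp_zero] at h
      linarith
    have hp := Real.exp_pos y
    rcases le_total 0 y with hy | hy
    · nlinarith [mul_le_mul_of_nonneg_left h2 hy, sq_nonneg y]
    · nlinarith [mul_le_mul_of_nonneg_left h1 (neg_nonneg.2 hy), mul_nonneg (sq_nonneg y) hp.le]
  have hsq : x ^ 2 ≤ 2 * (Real.exp x + Real.exp (-x)) := by
    have hp := Real.exp_pos x
    have hn := Real.exp_pos (-x)
    rcases le_total 0 x with hx | hx
    · nlinarith [Real.quadratic_le_exp_of_nonneg hx]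
    · nlinarith [Real.quadratic_le_exp_of_nonneg (neg_nonneg.2 hx)]
  have hexp : Real.exp (t * x) ≤ Real.exp x + 1 := by
    rcases le_total 0 x with hx | hx
    · have : Real.exp (t * x) ≤ Real.exp x := Real.exp_le_exp.2 (by nlinarith)
      linarith
    · have : Real.exp (t * x) ≤ 1 := Real.exp_le_one_iff.2 (by nlinarith)
      linarith [Real.exp_pos x]
  have hprod : x ^ 2 * (Real.exp (t * x) + 1) ≤
      2 * Real.exp (2 * x) + 2 + 4 * Real.exp x + 4 * Real.exp (-x) := by
    calc x ^ 2 * (Real.exp (t * x) + 1)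
        ≤ 2 * (Real.exp x + Real.exp (-x)) * ((Real.exp x + 1) + 1) := by gcongr
      _ = 2 * (Real.exp x * Real.exp x) + 2 * (Real.exp x * Real.exp (-x))
            + 4 * Real.exp x + 4 * Real.exp (-x) := by ring
      _ = _ := by
        rw [← Real.exp_add, ← Real.exp_add, add_neg_cancel, Real.exp_zero]
        ring_nf
  have := key (t * x)
  nlinarith [mul_le_mul_of_nonneg_left hprod (sq_nonneg t)]

section JumpGeneratingFunction

variable {d : ℕ} {ν : Zd d → ℝ}

theorem jgf_nonneg (hν : ∀ z, 0 ≤ ν z) (a : Rd d) : 0 ≤ jgf d ν a :=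
  tsum_nonneg fun z => mul_nonneg (hν z) (Real.exp_pos _).le

theorem summable_mul_dotZ (hν : ∀ z, 0 ≤ ν z)
    (hs : ∀ a : Rd d, Summable fun z => ν z * Real.exp (dotZ d a z)) (b : Rd d) :
    Summable fun z => ν z * dotZ d b z := by
  refine Summable.of_norm_bounded ((hs b).add (hs ((-1 : ℝ) • b))) fun z => ?_
  have h : dotZ d ((-1 : ℝ) • b) z = -dotZ d b z := by
    rw [dotZ_eq_dotR, dotR_smul_left, dotZ_eq_dotR]; ring
  rw [norm_mul, Real.norm_of_nonneg (hν z), ← mul_add, h]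
  refine mul_le_mul_of_nonneg_left (abs_le.2 ⟨?_, ?_⟩) (hν z)
  · linarith [Real.add_one_le_exp (-dotZ d b z), Real.exp_pos (dotZ d b z)]
  · linarith [Real.add_one_le_exp (dotZ d b z), Real.exp_pos (-dotZ d b z)]

theorem hasSum_mul_dotZ (hν : ∀ z, 0 ≤ ν z)
    (hs : ∀ a : Rd d, Summable fun z => ν z * Real.exp (dotZ d a z)) (b : Rd d) :
    HasSum (fun z => ν z * dotZ d b z) (dotR d b (meanVec d ν)) := by
  have h1 : ∀ i, Summable fun z : Zd d => ν z * (z.1 i : ℝ) := fun i => by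
    simpa [dotZ, Pi.single_apply] using
      summable_mul_dotZ hν hs ((Pi.single i 1, 0) : Rd d)
  have h2 : Summable fun z : Zd d => ν z * (z.2 : ℝ) := by
    simpa [dotZ] using summable_mul_dotZ hν hs ((0, 1) : Rd d)
  have h := (hasSum_sum (s := Finset.univ) fun i _ => (h1 i).hasSum.mul_left (b.1 i)).add
    (h2.hasSum.mul_left b.2)
  refine h.congr_fun ?_
  intro z
  simp only [dotZ, mul_add, Finset.mul_sum]
  congr 1
  · exact Finset.sum_congr rfl fun i _ => by ring
  · ring

/-- The jump generating function drops below `1` along directions in which the mean is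
negative. -/
theorem eventually_jgf_smul_lt_one (hν : IsProb d ν)
    (hs : ∀ a : Rd d, Summable fun z => ν z * Real.exp (dotZ d a z)) {v : Rd d}
    (hv : dotR d v (meanVec d ν) < 0) :
    ∀ᶠ t : ℝ in nhdsWithin 0 (Set.Ioi 0), jgf d ν (t • v) < 1 := by
  have hsmul : ∀ (t : ℝ) (z : Zd d), dotZ d (t • v) z = t * dotZ d v z := fun t z => by
    rw [dotZ_eq_dotR, dotR_smul_left, dotZ_eq_dotR]
  obtain ⟨C, hC⟩ : ∃ C, HasSum (fun z => ν z * (2 * Real.exp (2 * dotZ d v z) + 2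
      + 4 * Real.exp (dotZ d v z) + 4 * Real.exp (-dotZ d v z))) C := by
    have h := ((((hs ((2 : ℝ) • v)).mul_left 2).add (hν.2.summable.mul_left 2)).add
      ((hs v).mul_left 4)).add ((hs ((-1 : ℝ) • v)).mul_left 4)
    refine ⟨_, (h.congr fun z => ?_).hasSum⟩
    rw [hsmul, hsmul, neg_one_mul]
    ring
  have hlim : Tendsto (fun t : ℝ => dotR d v (meanVec d ν) + t * C)
      (nhdsWithin 0 (Set.Ioi 0)) (nhds (dotR d v (meanVec d ν))) := by
    have : Continuous fun t : ℝ => dotR d v (meanVec d ν) + t * C := by fun_prop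
    simpa using (this.tendsto 0).mono_left nhdsWithin_le_nhds
  filter_upwards [hlim.eventually_lt_const hv, self_mem_nhdsWithin,
    nhdsWithin_le_nhds (Iic_mem_nhds (zero_lt_one' ℝ))] with t ht ht0 ht1
  have ht0 : 0 < t := ht0
  have hle : jgf d ν (t • v) ≤ 1 + t * dotR d v (meanVec d ν) + t ^ 2 * C := by
    refine hasSum_le (fun z => ?_) (hs (t • v)).hasSum
      ((hν.2.add ((hasSum_mul_dotZ hν.1 hs v).mul_left t)).add (hC.mul_left (t ^ 2)))
    have := mul_le_mul_of_nonneg_left (exp_mul_le_quadratic ht0.le ht1 (dotZ d v z)) (hν.1 z)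
    rw [hsmul]
    linarith
  nlinarith [mul_neg_of_pos_of_neg ht0 ht]

theorem convexOn_jgf (hν : ∀ z, 0 ≤ ν z)
    (hs : ∀ a : Rd d, Summable fun z => ν z * Real.exp (dotZ d a z)) :
    ConvexOn ℝ Set.univ (jgf d ν) := by
  refine ⟨convex_univ, fun a _ b _ p q hp hq hpq => ?_⟩
  refine hasSum_le (fun z => ?_) (hs (p • a + q • b)).hasSum
    (((hs a).hasSum.mul_left p).add ((hs b).hasSum.mul_left q))
  have h := convexOn_exp.2 (Set.mem_univ (dotZ d a z)) (Set.mem_univ (dotZ d b z)) hp hq hpq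
  simp only [smul_eq_mul] at h
  have h' := mul_le_mul_of_nonneg_left h (hν z)
  rw [dotZ_eq_dotR, dotR_add_left, dotR_smul_left, dotR_smul_left, ← dotZ_eq_dotR,
    ← dotZ_eq_dotR]
  linarith

theorem continuous_jgf (hν : ∀ z, 0 ≤ ν z)
    (hs : ∀ a : Rd d, Summable fun z => ν z * Real.exp (dotZ d a z)) :
    Continuous (jgf d ν) :=
  continuousOn_univ.1 ((convexOn_jgf hν hs).continuousOn isOpen_univ)

/-- If `φ(a) ≤ 1`, then `e^{a·z}` is superharmonic for the iterated kernels of the homogeneous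
walk. -/
theorem tsum_stepSn_mul_exp_le (hν : ∀ z, 0 ≤ ν z)
    (hs : ∀ a : Rd d, Summable fun z => ν z * Real.exp (dotZ d a z)) {a : Rd d}
    (ha : jgf d ν a ≤ 1) (n : ℕ) (z : Zd d) :
    ∑' z', stepSn d ν n z z' * ENNReal.ofReal (Real.exp (dotZ d a z'))
      ≤ ENNReal.ofReal (Real.exp (dotZ d a z)) := by
  have hadd : ∀ w w' : Zd d, dotZ d a (w' + w) = dotZ d a w' + dotZ d a w := fun w w' => by
    simp only [dotZ, Prod.fst_add, Prod.snd_add, Pi.add_apply, Int.cast_add, mul_add,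
      Finset.sum_add_distrib]
    ring
  have hone : ∀ w : Zd d, ∑' z', stepS d ν w z' * ENNReal.ofReal (Real.exp (dotZ d a z'))
      ≤ ENNReal.ofReal (Real.exp (dotZ d a w)) := by
    intro w
    rw [← (Equiv.addRight w).tsum_eq]
    have h : ∀ u : Zd d, stepS d ν w (Equiv.addRight w u)
        * ENNReal.ofReal (Real.exp (dotZ d a (Equiv.addRight w u)))
        = ENNReal.ofReal (ν u * Real.exp (dotZ d a u))
          * ENNReal.ofReal (Real.exp (dotZ d a w)) := fun u => by
      rw [Equiv.coe_addRight, stepS, add_sub_cancel_right, hadd, Real.exp_add,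
        ENNReal.ofReal_mul (Real.exp_pos _).le, ENNReal.ofReal_mul (hν u), mul_assoc]
    simp_rw [h]
    rw [ENNReal.tsum_mul_right, ← ENNReal.ofReal_tsum_of_nonneg
      (fun u => mul_nonneg (hν u) (Real.exp_pos _).le) (hs a)]
    exact mul_le_of_le_one_left zero_le (ENNReal.ofReal_le_one.2 ha)
  induction n with
  | zero => simp [stepSn, kerIter]
  | succ n ih =>
    have hstep : ∀ z', stepSn d ν (n + 1) z z'
        = ∑' w, stepSn d ν n z w * stepS d ν w z' := fun _ => rfl
    simp_rw [hstep, ← ENNReal.tsum_mul_right]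
    rw [ENNReal.tsum_comm]
    refine le_trans (ENNReal.tsum_le_tsum fun w => ?_) ih
    simp_rw [mul_assoc]
    rw [ENNReal.tsum_mul_left]
    gcongr
    exact hone w

theorem bddAbove_dotZ_of_irreducible (hν : ∀ z, 0 ≤ ν z)
    (hs : ∀ a : Rd d, Summable fun z => ν z * Real.exp (dotZ d a z))
    (hirr : ∀ z z' : Zd d, ∃ n : ℕ, 0 < stepSn d ν n z z') (z : Zd d) :
    ∃ C : ℝ, ∀ a ∈ Dset d ν, dotZ d a z ≤ C := by
  obtain ⟨n, hn⟩ := hirr 0 z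
  set p := stepSn d ν n 0 z
  have hbound : ∀ a ∈ Dset d ν, p * ENNReal.ofReal (Real.exp (dotZ d a z)) ≤ 1 := fun a ha => by
    refine ((ENNReal.le_tsum z).trans (tsum_stepSn_mul_exp_le hν hs ha n 0)).trans ?_
    simp [dotZ]
  refine ⟨p⁻¹.toReal, fun a ha => ?_⟩
  have h : ENNReal.ofReal (Real.exp (dotZ d a z)) ≤ p⁻¹ := by
    rw [ENNReal.le_inv_iff_mul_le, mul_comm]
    exact hbound a ha
  have h' := ENNReal.toReal_mono (ENNReal.inv_ne_top.2 hn.ne') h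
  rw [ENNReal.toReal_ofReal (Real.exp_pos _).le] at h'
  linarith [Real.add_one_le_exp (dotZ d a z)]

/-- Irreducibility of the homogeneous walk makes `D` bounded. -/
theorem bddAbove_dotR_of_irreducible (hν : ∀ z, 0 ≤ ν z)
    (hs : ∀ a : Rd d, Summable fun z => ν z * Real.exp (dotZ d a z))
    (hirr : ∀ z z' : Zd d, ∃ n : ℕ, 0 < stepSn d ν n z z') (q : Rd d) :
    ∃ C : ℝ, ∀ a ∈ Dset d ν, dotR d a q ≤ C := by
  have hB := bddAbove_dotZ_of_irreducible hν hs hirr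
  have hscalar : ∀ (f : Rd d → ℝ) (c : ℝ), (∃ C, ∀ a ∈ Dset d ν, f a ≤ C) →
      (∃ C, ∀ a ∈ Dset d ν, -f a ≤ C) → ∃ C, ∀ a ∈ Dset d ν, f a * c ≤ C := by
    rintro f c ⟨C, hC⟩ ⟨C', hC'⟩
    rcases le_total 0 c with hc | hc
    · exact ⟨C * c, fun a ha => mul_le_mul_of_nonneg_right (hC a ha) hc⟩
    · exact ⟨C' * -c, fun a ha => by nlinarith [hC' a ha]⟩
  have h1 : ∀ i, ∃ C, ∀ a ∈ Dset d ν, a.1 i * q.1 i ≤ C := fun i => by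
    refine hscalar (fun a => a.1 i) _ ?_ ?_
    · simpa [dotZ, Pi.single_apply] using hB (Pi.single i 1, 0)
    · simpa [dotZ, Pi.single_apply] using hB (-Pi.single i 1, 0)
  have h2 : ∃ C, ∀ a ∈ Dset d ν, a.2 * q.2 ≤ C := by
    refine hscalar (fun a => a.2) _ ?_ ?_
    · simpa [dotZ] using hB (0, 1)
    · simpa [dotZ] using hB (0, -1)
  choose C hC using h1
  obtain ⟨C', hC'⟩ := h2
  exact ⟨∑ i, C i + C', fun a ha =>
    add_le_add (Finset.sum_le_sum fun i _ => hC i a ha) (hC' a ha)⟩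

end JumpGeneratingFunction

theorem mem_Dhat_of_jgf_le_one {d : ℕ} {μ μ0 : Zd d → ℝ} (hμ : ∀ z, 0 ≤ μ z) {a : Rd d}
    (h : jgf d μ a ≤ 1) (h0 : jgf d μ0 a ≤ 1) : a ∈ Dhat d μ μ0 := by
  refine ⟨?_, h⟩
  refine ciInf_le_of_le (f := fun β : ℝ => max (jgf d μ (a.1, β)) (jgf d μ0 (a.1, β)))
    ⟨0, ?_⟩ a.2 (max_le h h0)
  rintro _ ⟨β, rfl⟩
  exact le_max_of_le_left (jgf_nonneg hμ _)

/-- The set where both jump generating functions are at most `1` has nonempty interior. -/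
theorem exists_ball_jgf_lt_one {d : ℕ} {μ μ0 : Zd d → ℝ} (hμ : IsProb d μ) (hμ0 : IsProb d μ0)
    (hH3 : H3 d μ μ0) (hH4 : H4 d μ μ0) :
    ∃ (v : Rd d) (r : ℝ), 0 < r ∧ ∀ a : Rd d, ‖a - v‖ < r →
      jgf d μ a < 1 ∧ jgf d μ0 a < 1 := by
  obtain ⟨u, hu, hu0⟩ := exists_dotR_neg_of_not_opposite d hH3.1 hH3.2.1 hH3.2.2
  obtain ⟨t, ht, ht0⟩ := ((eventually_jgf_smul_lt_one hμ (fun a => (hH4 a).1) hu).and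
    (eventually_jgf_smul_lt_one hμ0 (fun a => (hH4 a).2) hu0)).exists
  have hev : ∀ᶠ a in nhds (t • u), jgf d μ a < 1 ∧ jgf d μ0 a < 1 :=
    (((continuous_jgf hμ.1 fun a => (hH4 a).1).tendsto _).eventually_lt_const ht).and
      (((continuous_jgf hμ0.1 fun a => (hH4 a).2).tendsto _).eventually_lt_const ht0)
  obtain ⟨r, hr, h⟩ := Metric.eventually_nhds_iff.1 hev
  exact ⟨t • u, r, hr, fun a ha => h (by rwa [dist_eq_norm])⟩

/-- `I_min = inf_{γ ∈ ℝ^{d-1}×{0}, |γ|=1} (I(0,γ) + I⁺(γ,0)) > 0`. -/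
theorem Imin_positive
    (d : ℕ) (hd : 2 ≤ d) (μ μ0 : Zd d → ℝ)
    (hμ : IsProb d μ) (hμ0 : IsProb d μ0)
    (hH0 : H0 d μ μ0) (hH1 : H1 d μ μ0) (hH2 : H2 d μ)
    (hH3 : H3 d μ μ0) (hH4 : H4 d μ μ0) :
    0 < ⨅ γ : {γ : Rd d // γ.2 = 0 ∧ ‖γ‖ = 1},
      ((⨆ a : ↥(Dhat d μ μ0), dotR d (a : Rd d) (γ : Rd d)) +
        ⨆ a : ↥(Dset d μ), dotR d (a : Rd d) (-(γ : Rd d))) := by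
  obtain ⟨v, r, hr, hball⟩ := exists_ball_jgf_lt_one hμ hμ0 hH3 hH4
  have hbdd := bddAbove_dotR_of_irreducible hμ.1 (fun a => (hH4 a).1) hH2.1
  have : Nonempty {γ : Rd d // γ.2 = 0 ∧ ‖γ‖ = 1} := by
    have : Nonempty (Fin (d - 1)) := ⟨⟨0, by omega⟩⟩
    exact ⟨⟨(fun _ => 1, 0), rfl, by simp [Prod.norm_def]⟩⟩
  refine lt_of_lt_of_le (half_pos hr) (le_ciInf ?_)
  rintro ⟨γ, -, hγ⟩
  obtain ⟨C, hC⟩ := hbdd γ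
  obtain ⟨C', hC'⟩ := hbdd (-γ)
  have ha := hball (v + (r / 2) • γ) (by
    rw [add_sub_cancel_left, norm_smul, hγ, mul_one, Real.norm_of_nonneg (by positivity)]
    linarith)
  have hv := hball v (by simpa using hr)
  have h1 : dotR d (v + (r / 2) • γ) γ ≤ ⨆ a : ↥(Dhat d μ μ0), dotR d (a : Rd d) γ :=
    le_ciSup (f := fun a : ↥(Dhat d μ μ0) => dotR d (a : Rd d) γ)
      ⟨C, by rintro _ ⟨a, rfl⟩; exact hC a a.2.2⟩
      ⟨_, mem_Dhat_of_jgf_le_one hμ.1 ha.1.le ha.2.le⟩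
  have h2 : dotR d v (-γ) ≤ ⨆ a : ↥(Dset d μ), dotR d (a : Rd d) (-γ) :=
    le_ciSup (f := fun a : ↥(Dset d μ) => dotR d (a : Rd d) (-γ))
      ⟨C', by rintro _ ⟨a, rfl⟩; exact hC' a a.2⟩ ⟨v, hv.1.le⟩
  have h3 := norm_sq_le_dotR_self d γ
  rw [dotR_add_left, dotR_smul_left] at h1
  rw [dotR_neg_right] at h2
  rw [hγ] at h3
  show r / 2 ≤ (⨆ a : ↥(Dhat d μ μ0), dotR d (a : Rd d) γ) +
    ⨆ a : ↥(Dset d μ), dotR d (a : Rd d) (-γ)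
  nlinarith

end ReflectedRW
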